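/- Let ε ∈ (0, 1/|𝒫|), let η be the uniform distribution on Δ (the normalized (|𝒫|−1)-dimensional Hausdorff measure restricted to the simplex Δ), and for each edge e define the perturbed cost C_e^ε(x) = (1 − ε) C_e(x) + ε ∫_Δ C_e(τ′(e)) dη(τ′). Suppose τ^ε ∈ Δ minimizes Σ_{e ∈ E} ∫_0^{τ(e)} C_e^ε(x) dx over all τ ∈ Δ satisfying τ(p) ≥ ε for every p ∈ 𝒫. Then the symmetric randomized strategy profile h^ε with h^ε(i) = τ^ε for every i ∈ I is an ε-robust perfect equilibrium, with perturbed player space equal to all of I and perturbation function φ(τ) = (1 − ε)δ_τ + εη. -/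

import Mathlib

open MeasureTheory Filter Topology

section RobustPerfect

variable {I : Type*} [MeasurableSpace I] {A : Type*} [Fintype A]

/-- The societal summary of a randomized strategy profile. -/
noncomputable def socSum (lam : Measure I) (h : I → A → ℝ) : A → ℝ :=
  fun a => ∫ i, h i a ∂lam

/-- `h` is a randomized strategy profile: a measurable map into the simplex. -/
def IsProfile (lam : Measure I) (h : I → A → ℝ) : Prop :=
  Measurable h ∧ ∀ i, h i ∈ stdSimplex ℝ A

/-- A large game: payoffs continuous on the simplex and measurable in the player. -/
def IsLargeGame (u : I → A → (A → ℝ) → ℝ) : Prop :=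
  (∀ i a, ContinuousOn (u i a) (stdSimplex ℝ A)) ∧
  (∀ (a : A) (τ : A → ℝ), τ ∈ stdSimplex ℝ A → Measurable fun i => u i a τ)

/-- An atomless measure. -/
def MeasAtomless (lam : Measure I) : Prop :=
  ∀ s : Set I, MeasurableSet s → 0 < lam s →
    ∃ t : Set I, MeasurableSet t ∧ t ⊆ s ∧ 0 < lam t ∧ lam t < lam s

/-- A Borel probability measure concentrated on the simplex with full support on it. -/
def FullSupportOnSimplex (η : Measure (A → ℝ)) : Prop :=
  IsProbabilityMeasure η ∧ η (stdSimplex ℝ A)ᶜ = 0 ∧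
    ∀ U : Set (A → ℝ), IsOpen U → (U ∩ stdSimplex ℝ A).Nonempty → 0 < η U

/-- A perturbation function: a Borel measurable map from the simplex to the
full-support Borel probability measures on the simplex. -/
def IsPerturbation (φ : (A → ℝ) → Measure (A → ℝ)) : Prop :=
  (∀ τ ∈ stdSimplex ℝ A, FullSupportOnSimplex (φ τ)) ∧
  ∀ f : (A → ℝ) → ℝ, Continuous f → Measurable fun τ => ∫ x, f x ∂(φ τ)

/-- Expected payoff of action `a` against a distribution over societal summaries. -/
noncomputable def payM (ui : A → (A → ℝ) → ℝ) (a : A) (ν : Measure (A → ℝ)) : ℝ :=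
  ∫ τ, ui a τ ∂ν

/-- Randomized strategy Nash equilibrium. -/
def IsNash (lam : Measure I) (u : I → A → (A → ℝ) → ℝ) (h : I → A → ℝ) : Prop :=
  IsProfile lam h ∧
  ∀ᵐ i ∂lam, ∀ μ ∈ stdSimplex ℝ A,
    ∑ a, μ a * u i a (socSum lam h) ≤ ∑ a, h i a * u i a (socSum lam h)

/-- A weakly dominated action. -/
def WeaklyDominated (ui : A → (A → ℝ) → ℝ) (a : A) : Prop :=
  ∃ μ ∈ stdSimplex ℝ A,
    (∀ τ ∈ stdSimplex ℝ A, ui a τ ≤ ∑ b, μ b * ui b τ) ∧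
    (∃ τ ∈ stdSimplex ℝ A, ui a τ < ∑ b, μ b * ui b τ)

/-- Admissibility: almost no player puts weight on a weakly dominated action. -/
def Admissible (lam : Measure I) (u : I → A → (A → ℝ) → ℝ) (h : I → A → ℝ) : Prop :=
  ∀ᵐ i ∂lam, ∀ a : A, WeaklyDominated (u i) a → h i a = 0

/-- Weak convergence of a sequence of measures to a Dirac measure. -/
def WeakTendstoDirac (ν : ℕ → Measure (A → ℝ)) (τ : A → ℝ) : Prop :=
  ∀ f : (A → ℝ) → ℝ, Continuous f →
    Tendsto (fun n => ∫ x, f x ∂(ν n)) atTop (nhds (f τ))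

/-- Aggregate robustness. -/
def AggregateRobust (lam : Measure I) (u : I → A → (A → ℝ) → ℝ) (h : I → A → ℝ) : Prop :=
  ∀ᵐ i ∂lam, ∃ φ : ℕ → (A → ℝ) → Measure (A → ℝ),
    (∀ n, IsPerturbation (φ n)) ∧
    (∀ τ ∈ stdSimplex ℝ A, WeakTendstoDirac (fun n => φ n τ) τ) ∧
    ∀ n, ∀ μ ∈ stdSimplex ℝ A,
      ∑ a, μ a * payM (u i) a (φ n (socSum lam h)) ≤
        ∑ a, h i a * payM (u i) a (φ n (socSum lam h))

/-- `ε`-robust perfect equilibrium with perturbed player space `Iε` and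
perturbation function `φ`. -/
def IsEpsRPE (lam : Measure I) (u : I → A → (A → ℝ) → ℝ) (ε : ℝ)
    (h : I → A → ℝ) (Iε : Set I) (φ : (A → ℝ) → Measure (A → ℝ)) : Prop :=
  IsProfile lam h ∧
  (∀ᵐ i ∂lam, ∀ a : A, 0 < h i a) ∧
  MeasurableSet Iε ∧ ENNReal.ofReal (1 - ε) < lam Iε ∧
  IsPerturbation φ ∧
  (∀ τ ∈ stdSimplex ℝ A, ENNReal.ofReal (1 - ε) ≤ φ τ {τ}) ∧
  ∀ i ∈ Iε, ∀ am al : A,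
    payM (u i) am (φ (socSum lam h)) < payM (u i) al (φ (socSum lam h)) →
      h i am ≤ ε

/-- Robust perfect equilibrium. -/
def IsRPE (lam : Measure I) (u : I → A → (A → ℝ) → ℝ) (h : I → A → ℝ) : Prop :=
  IsProfile lam h ∧
  ∃ (ε : ℕ → ℝ) (hs : ℕ → I → A → ℝ) (Is : ℕ → Set I)
      (φs : ℕ → (A → ℝ) → Measure (A → ℝ)),
    (∀ n, 0 < ε n) ∧ Tendsto ε atTop (nhds 0) ∧
    (∀ n, IsEpsRPE lam u (ε n) (hs n) (Is n) (φs n)) ∧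
    (∀ᵐ i ∂lam, ∃ nk : ℕ → ℕ, StrictMono nk ∧ (∀ k, i ∈ Is (nk k)) ∧
      Tendsto (fun k => hs (nk k) i) atTop (nhds (h i))) ∧
    Tendsto (fun n => socSum lam (hs n)) atTop (nhds (socSum lam h))

/-- The Dirac randomized strategy profile induced by a pure strategy profile. -/
def diracProfile [DecidableEq A] (f : I → A) : I → A → ℝ :=
  fun i a => if a = f i then 1 else 0

end RobustPerfect

section Congestion

variable {E P : Type*} [Fintype E] [Fintype P] [DecidableEq E]

/-- The load of edge `e` under the path-flow `τ`. -/
def edgeLoad (edgeOf : P → Finset E) (τ : P → ℝ) (e : E) : ℝ :=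
  ∑ p : P, if e ∈ edgeOf p then τ p else 0

/-- The cost of path `p` under the path-flow `τ`. -/
def pathCost (edgeOf : P → Finset E) (C : E → ℝ → ℝ) (p : P) (τ : P → ℝ) : ℝ :=
  ∑ e ∈ edgeOf p, C e (edgeLoad edgeOf τ e)

/-- Nonnegative, continuous and monotone increasing edge cost functions on `[0,1]`. -/
def IsCongestionCost (C : E → ℝ → ℝ) : Prop :=
  ∀ e, ContinuousOn (C e) (Set.Icc (0:ℝ) 1) ∧ MonotoneOn (C e) (Set.Icc (0:ℝ) 1) ∧
    ∀ x ∈ Set.Icc (0:ℝ) 1, 0 ≤ C e x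

/-- The common payoff of the congestion game: the negative of the path cost. -/
def congPayoff (I : Type*) (edgeOf : P → Finset E) (C : E → ℝ → ℝ) :
    I → P → (P → ℝ) → ℝ :=
  fun _ p τ => -(pathCost edgeOf C p τ)

/-- The uniform distribution on the simplex: the normalized
`(card P - 1)`-dimensional Hausdorff measure restricted to the simplex. -/
noncomputable def unifSimplex (P : Type*) [Fintype P] : Measure (P → ℝ) :=
  (μH[(Fintype.card P : ℝ) - 1] (stdSimplex ℝ P))⁻¹ •
    (μH[(Fintype.card P : ℝ) - 1]).restrict (stdSimplex ℝ P)

/-- The perturbation function `τ ↦ (1-ε)δ_τ + ε η`. -/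
noncomputable def pertOf {A : Type*} [Fintype A] (ε : ℝ) (η : Measure (A → ℝ)) :
    (A → ℝ) → Measure (A → ℝ) :=
  fun τ => ENNReal.ofReal (1 - ε) • Measure.dirac τ + ENNReal.ofReal ε • η

end Congestion

/-- The perturbed edge cost `C_e^ε(x) = (1-ε) C_e(x) + ε ∫_Δ C_e(τ'(e)) dη(τ')`,
with `η` the uniform distribution on the simplex. -/
noncomputable def pertCost {E P : Type*} [Fintype E] [Fintype P] [DecidableEq E]
    (edgeOf : P → Finset E) (C : E → ℝ → ℝ) (ε : ℝ) (e : E) (x : ℝ) : ℝ :=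
  (1 - ε) * C e x + ε * ∫ τ', C e (edgeLoad edgeOf τ' e) ∂(unifSimplex P)

section UniformSimplex

variable {P : Type*} [Fintype P]

/-- The point of the hyperplane `∑ p, x p = 1` with prescribed coordinates away from `p₀`. -/
noncomputable def hyperplaneLift [DecidableEq P] (p₀ : P) (x : {p : P // p ≠ p₀} → ℝ) : P → ℝ :=
  fun p => if h : p = p₀ then 1 - ∑ q, x q else x ⟨p, h⟩

/-- Forgetting the coordinate `p₀`. -/
def dropCoord (p₀ : P) (τ : P → ℝ) : {p : P // p ≠ p₀} → ℝ :=
  fun q => τ q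

lemma lipschitzWith_dropCoord [DecidableEq P] (p₀ : P) : LipschitzWith 1 (dropCoord p₀) := by
  refine LipschitzWith.of_dist_le_mul fun x y => ?_
  rw [NNReal.coe_one, one_mul]
  exact (dist_pi_le_iff dist_nonneg).2 fun q => dist_le_pi_dist x y q

lemma sum_eq_add_sum_dropCoord [DecidableEq P] (p₀ : P) (τ : P → ℝ) :
    ∑ p, τ p = τ p₀ + ∑ q, dropCoord p₀ τ q := by
  rw [Fintype.sum_eq_add_sum_subtype_ne τ p₀]
  rfl

lemma hyperplaneLift_dropCoord [DecidableEq P] (p₀ : P) {τ : P → ℝ} (hτ : ∑ p, τ p = 1) :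
    hyperplaneLift p₀ (dropCoord p₀ τ) = τ := by
  funext p
  rw [sum_eq_add_sum_dropCoord p₀] at hτ
  by_cases h : p = p₀
  · subst h
    simp only [hyperplaneLift, dite_true]
    linarith
  · simp [hyperplaneLift, h, dropCoord]

lemma dropCoord_hyperplaneLift [DecidableEq P] (p₀ : P) (x : {p : P // p ≠ p₀} → ℝ) :
    dropCoord p₀ (hyperplaneLift p₀ x) = x := by
  funext q
  simp [dropCoord, hyperplaneLift, q.2]

lemma sum_hyperplaneLift [DecidableEq P] (p₀ : P) (x : {p : P // p ≠ p₀} → ℝ) :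
    ∑ p, hyperplaneLift p₀ x p = 1 := by
  rw [sum_eq_add_sum_dropCoord p₀, dropCoord_hyperplaneLift]
  simp [hyperplaneLift]

lemma lipschitzWith_hyperplaneLift [DecidableEq P] (p₀ : P) :
    LipschitzWith (Fintype.card P) (hyperplaneLift p₀) := by
  have hcard : (1 : ℝ) ≤ Fintype.card P := by
    exact_mod_cast Fintype.card_pos_iff.2 ⟨p₀⟩
  refine LipschitzWith.of_dist_le_mul fun x y => ?_
  rw [NNReal.coe_natCast]
  refine (dist_pi_le_iff (by positivity)).2 fun p => ?_
  by_cases h : p = p₀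
  · simp only [hyperplaneLift, h, dite_true, dist_sub_left]
    calc dist (∑ q, x q) (∑ q, y q) ≤ ∑ q, dist (x q) (y q) := dist_sum_sum_le _ _ _
      _ ≤ ∑ _q : {p : P // p ≠ p₀}, dist x y := Finset.sum_le_sum fun q _ => dist_le_pi_dist x y q
      _ = (Fintype.card {p : P // p ≠ p₀} : ℝ) * dist x y := by simp
      _ ≤ Fintype.card P * dist x y := by
        gcongr
        exact Fintype.card_subtype_le _
  · simp only [hyperplaneLift, h, dite_false]
    exact (dist_le_pi_dist x y ⟨p, h⟩).trans (le_mul_of_one_le_left dist_nonneg hcard)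

lemma card_sub_one_eq_card_ne [DecidableEq P] (p₀ : P) :
    (Fintype.card P : ℝ) - 1 = (Fintype.card {p : P // p ≠ p₀} : ℝ) := by
  have : 1 ≤ Fintype.card P := Fintype.card_pos_iff.2 ⟨p₀⟩
  rw [Fintype.card_subtype_compl, Fintype.card_subtype_eq, Nat.cast_sub this, Nat.cast_one]

lemma hausdorffMeasure_stdSimplex_lt_top [Nonempty P] :
    μH[(Fintype.card P : ℝ) - 1] (stdSimplex ℝ P) < ⊤ := by
  classical
  obtain ⟨p₀⟩ := ‹Nonempty P›
  rw [card_sub_one_eq_card_ne p₀]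
  have himage : hyperplaneLift p₀ '' (dropCoord p₀ '' stdSimplex ℝ P) = stdSimplex ℝ P := by
    rw [Set.image_image]
    exact (Set.image_congr fun τ hτ => hyperplaneLift_dropCoord p₀ hτ.2).trans (Set.image_id _)
  have hcompact : IsCompact (dropCoord p₀ '' stdSimplex ℝ P) :=
    (isCompact_stdSimplex ℝ P).image (lipschitzWith_dropCoord p₀).continuous
  have hle := (lipschitzWith_hyperplaneLift p₀).hausdorffMeasure_image_le
    (Nat.cast_nonneg (Fintype.card {p : P // p ≠ p₀})) (dropCoord p₀ '' stdSimplex ℝ P)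
  rw [himage, hausdorffMeasure_pi_real] at hle
  refine hle.trans_lt (ENNReal.mul_lt_top ?_ hcompact.measure_lt_top)
  exact ENNReal.rpow_lt_top_of_nonneg (Nat.cast_nonneg _) ENNReal.coe_ne_top

/-- Every point of the simplex is a limit of points of the simplex with positive coordinates. -/
lemma exists_pos_mem_of_isOpen [Nonempty P] {U : Set (P → ℝ)} (hU : IsOpen U)
    (hne : (U ∩ stdSimplex ℝ P).Nonempty) :
    ∃ τ ∈ U, (∀ p, 0 < τ p) ∧ ∑ p, τ p = 1 := by
  obtain ⟨τ, hτU, hτ⟩ := hne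
  let γ : ℝ → P → ℝ := fun t p => (1 - t) * τ p + t * (Fintype.card P : ℝ)⁻¹
  have hγ : Continuous γ := by fun_prop
  have hγ0 : γ 0 = τ := by funext p; simp [γ]
  have hev : ∀ᶠ t in 𝓝[>] (0 : ℝ), γ t ∈ U :=
    (hγ.tendsto 0).mono_left nhdsWithin_le_nhds (hU.mem_nhds (hγ0.symm ▸ hτU))
  obtain ⟨t, htU, ht0, ht1⟩ := (hev.and (Ioo_mem_nhdsGT (zero_lt_one' ℝ))).exists
  have hcard : (0 : ℝ) < Fintype.card P := by exact_mod_cast Fintype.card_pos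
  refine ⟨γ t, htU, fun p => ?_, ?_⟩
  · exact add_pos_of_nonneg_of_pos (mul_nonneg (by linarith) (hτ.1 p)) (by positivity)
  · simp only [γ, Finset.sum_add_distrib, ← Finset.mul_sum, hτ.2, Finset.sum_const,
      Finset.card_univ, nsmul_eq_mul]
    field_simp
    ring

lemma hausdorffMeasure_inter_stdSimplex_pos [Nonempty P] {U : Set (P → ℝ)} (hU : IsOpen U)
    (hne : (U ∩ stdSimplex ℝ P).Nonempty) :
    0 < μH[(Fintype.card P : ℝ) - 1] (U ∩ stdSimplex ℝ P) := by
  classical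
  obtain ⟨τ, hτU, hτpos, hτsum⟩ := exists_pos_mem_of_isOpen hU hne
  obtain ⟨p₀⟩ := ‹Nonempty P›
  rw [card_sub_one_eq_card_ne p₀]
  let V : Set ({p : P // p ≠ p₀} → ℝ) := hyperplaneLift p₀ ⁻¹' (U ∩ {σ | ∀ p, 0 < σ p})
  have hV : IsOpen V := by
    refine (hU.inter ?_).preimage (lipschitzWith_hyperplaneLift p₀).continuous
    simp only [Set.ofPred_forall]
    exact isOpen_iInter_of_finite fun p => isOpen_lt continuous_const (continuous_apply p)
  have hVne : V.Nonempty := by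
    refine ⟨dropCoord p₀ τ, ?_⟩
    simp only [V, Set.mem_preimage, hyperplaneLift_dropCoord p₀ hτsum]
    exact ⟨hτU, hτpos⟩
  have hVsub : V ⊆ dropCoord p₀ '' (U ∩ stdSimplex ℝ P) := fun x hx =>
    ⟨hyperplaneLift p₀ x, ⟨hx.1, fun p => (hx.2 p).le, sum_hyperplaneLift p₀ x⟩,
      dropCoord_hyperplaneLift p₀ x⟩
  have hle := (lipschitzWith_dropCoord p₀).hausdorffMeasure_image_le
    (Nat.cast_nonneg (Fintype.card {p : P // p ≠ p₀})) (U ∩ stdSimplex ℝ P)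
  rw [hausdorffMeasure_pi_real, ENNReal.coe_one, ENNReal.one_rpow, one_mul] at hle
  exact (hV.measure_pos volume hVne).trans_le ((measure_mono hVsub).trans hle)

lemma fullSupportOnSimplex_unifSimplex [Nonempty P] : FullSupportOnSimplex (unifSimplex P) := by
  classical
  have hmeas : MeasurableSet (stdSimplex ℝ P) := (isClosed_stdSimplex ℝ P).measurableSet
  have htop := (hausdorffMeasure_stdSimplex_lt_top (P := P)).ne
  have hne : (stdSimplex ℝ P).Nonempty := ⟨_, single_mem_stdSimplex ℝ (Classical.arbitrary P)⟩
  have hpos : μH[(Fintype.card P : ℝ) - 1] (stdSimplex ℝ P) ≠ 0 := by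
    simpa using (hausdorffMeasure_inter_stdSimplex_pos isOpen_univ (by simpa using hne)).ne'
  refine ⟨⟨?_⟩, ?_, fun U hU hUne => ?_⟩
  · simp [unifSimplex, ENNReal.inv_mul_cancel hpos htop]
  · simp [unifSimplex, Measure.restrict_apply hmeas.compl]
  · simp only [unifSimplex, Measure.smul_apply, smul_eq_mul, Measure.restrict_apply hU.measurableSet]
    exact ENNReal.mul_pos (ENNReal.inv_ne_zero.2 htop)
      (hausdorffMeasure_inter_stdSimplex_pos hU hUne).ne'

end UniformSimplex

section Perturbation

variable {A : Type*} [Fintype A] {ε : ℝ} {η : Measure (A → ℝ)}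

lemma ContinuousOn.integrable_of_fullSupportOnSimplex (hη : FullSupportOnSimplex η)
    {f : (A → ℝ) → ℝ} (hf : ContinuousOn f (stdSimplex ℝ A)) : Integrable f η := by
  have := hη.1
  have hrestrict : η.restrict (stdSimplex ℝ A) = η :=
    Measure.restrict_eq_self_of_ae_mem (mem_ae_iff.2 hη.2.1)
  have := hf.integrableOn_compact (μ := η) (isCompact_stdSimplex ℝ A)
  rwa [IntegrableOn, hrestrict] at this

lemma integral_pertOf (h0 : 0 ≤ ε) (h1 : ε ≤ 1) {f : (A → ℝ) → ℝ} (hf : Integrable f η)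
    (τ : A → ℝ) :
    ∫ x, f x ∂(pertOf ε η τ) = (1 - ε) * f τ + ε * ∫ x, f x ∂η := by
  have hdirac : Integrable f (Measure.dirac τ) := integrable_dirac (by simp)
  rw [pertOf, integral_add_measure (hdirac.smul_measure ENNReal.ofReal_ne_top)
    (hf.smul_measure ENNReal.ofReal_ne_top), integral_smul_measure, integral_smul_measure,
    integral_dirac, ENNReal.toReal_ofReal (by linarith), ENNReal.toReal_ofReal h0,
    smul_eq_mul, smul_eq_mul]

lemma isPerturbation_pertOf (h0 : 0 < ε) (h1 : ε ≤ 1) (hη : FullSupportOnSimplex η) :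
    IsPerturbation (pertOf ε η) := by
  have := hη.1
  refine ⟨fun τ hτ => ⟨⟨?_⟩, ?_, fun U hU hne => ?_⟩, fun f hf => ?_⟩
  · simp only [pertOf, Measure.add_apply, Measure.smul_apply, smul_eq_mul, measure_univ, mul_one]
    rw [← ENNReal.ofReal_add (by linarith) h0.le]
    simp
  · have hmeas : MeasurableSet (stdSimplex ℝ A) := (isClosed_stdSimplex ℝ A).measurableSet
    simp [pertOf, hη.2.1, Measure.dirac_apply' _ hmeas.compl, hτ]
  · have : 0 < ENNReal.ofReal ε * η U :=
      ENNReal.mul_pos (ENNReal.ofReal_pos.2 h0).ne' (hη.2.2 U hU hne).ne'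
    exact this.trans_le le_add_self
  · simp only [integral_pertOf h0.le h1
      (hf.continuousOn.integrable_of_fullSupportOnSimplex hη)]
    exact (hf.measurable.const_mul _).add_const _

lemma ofReal_le_pertOf_singleton (τ : A → ℝ) : ENNReal.ofReal (1 - ε) ≤ pertOf ε η τ {τ} := by
  simp [pertOf]

end Perturbation

/-- The gradient inequality for the integral of a monotone function. -/
lemma MonotoneOn.integral_sub_integral_le {c : ℝ → ℝ} (hc : MonotoneOn c (Set.Icc 0 1))
    {a b : ℝ} (ha : a ∈ Set.Icc (0 : ℝ) 1) (hb : b ∈ Set.Icc (0 : ℝ) 1) :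
    (∫ x in (0 : ℝ)..b, c x) - ∫ x in (0 : ℝ)..a, c x ≤ (b - a) * c b := by
  have hint : ∀ {y z : ℝ}, y ∈ Set.Icc (0 : ℝ) 1 → z ∈ Set.Icc (0 : ℝ) 1 →
      IntervalIntegrable c volume y z := fun hy hz =>
    (hc.mono (Set.uIcc_subset_Icc hy hz)).intervalIntegrable
  have h0 : (0 : ℝ) ∈ Set.Icc (0 : ℝ) 1 := by simp
  rw [intervalIntegral.integral_interval_sub_left (hint h0 hb) (hint h0 ha)]
  rcases le_total a b with hab | hab
  · have := intervalIntegral.integral_mono_on hab (hint ha hb)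
      (intervalIntegrable_const (c := c b)) fun x hx =>
        hc ⟨ha.1.trans hx.1, hx.2.trans hb.2⟩ hb hx.2
    simpa using this
  · have := intervalIntegral.integral_mono_on hab (intervalIntegrable_const (c := c b))
      (hint hb ha) fun x hx => hc hb ⟨hb.1.trans hx.1, hx.2.trans ha.2⟩ hx.1
    rw [intervalIntegral.integral_symm]
    simp only [intervalIntegral.integral_const, smul_eq_mul] at this
    linarith

section CongestionGame

variable {E P : Type*} [Fintype P] [DecidableEq E] (edgeOf : P → Finset E)

lemma edgeLoad_mem_Icc {τ : P → ℝ} (hτ : τ ∈ stdSimplex ℝ P) (e : E) :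
    edgeLoad edgeOf τ e ∈ Set.Icc (0 : ℝ) 1 := by
  refine ⟨Finset.sum_nonneg fun p _ => ?_, hτ.2 ▸ Finset.sum_le_sum fun p _ => ?_⟩
  · split_ifs
    exacts [hτ.1 p, le_rfl]
  · split_ifs
    exacts [le_rfl, hτ.1 p]

lemma continuous_edgeLoad (e : E) : Continuous fun τ : P → ℝ => edgeLoad edgeOf τ e := by
  refine continuous_finsetSum _ fun p _ => ?_
  split_ifs
  exacts [continuous_apply p, continuous_const]

lemma edgeLoad_add_smul (τ σ : P → ℝ) (t : ℝ) (e : E) :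
    edgeLoad edgeOf (τ + t • σ) e = edgeLoad edgeOf τ e + t * edgeLoad edgeOf σ e := by
  simp only [edgeLoad, Finset.mul_sum, ← Finset.sum_add_distrib]
  refine Finset.sum_congr rfl fun p _ => ?_
  split_ifs <;> simp

lemma edgeLoad_single_sub_single [DecidableEq P] (p q : P) (e : E) :
    edgeLoad edgeOf (Pi.single p 1 - Pi.single q 1) e =
      (if e ∈ edgeOf p then 1 else 0) - if e ∈ edgeOf q then 1 else 0 := by
  have hsingle : ∀ r : P, (∑ x, if e ∈ edgeOf x then (Pi.single r 1 : P → ℝ) x else 0) =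
      if e ∈ edgeOf r then 1 else 0 := fun r => by
    rw [Finset.sum_eq_single r] <;> simp +contextual
  rw [← hsingle p, ← hsingle q, edgeLoad, ← Finset.sum_sub_distrib]
  refine Finset.sum_congr rfl fun x _ => ?_
  split_ifs <;> simp

variable {C : E → ℝ → ℝ} {ε : ℝ}

lemma continuousOn_comp_edgeLoad (hC : IsCongestionCost C) (e : E) :
    ContinuousOn (fun τ : P → ℝ => C e (edgeLoad edgeOf τ e)) (stdSimplex ℝ P) :=
  (hC e).1.comp (continuous_edgeLoad edgeOf e).continuousOn fun _ hτ => edgeLoad_mem_Icc edgeOf hτ e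

variable [Fintype E]

lemma continuousOn_pertCost (hC : IsCongestionCost C) (e : E) :
    ContinuousOn (pertCost edgeOf C ε e) (Set.Icc 0 1) :=
  (continuousOn_const.mul (hC e).1).add continuousOn_const

lemma monotoneOn_pertCost (hC : IsCongestionCost C) (h1 : ε ≤ 1) (e : E) :
    MonotoneOn (pertCost edgeOf C ε e) (Set.Icc 0 1) := fun x hx y hy hxy => by
  have := mul_le_mul_of_nonneg_left ((hC e).2.1 hx hy hxy) (sub_nonneg.2 h1)
  unfold pertCost
  linarith

/-- The expected payoff under the perturbed summary is the negative perturbed path cost. -/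
lemma payM_congPayoff_pertOf [Nonempty P] {I : Type*} (hC : IsCongestionCost C) (h0 : 0 ≤ ε)
    (h1 : ε ≤ 1) (i : I) (p : P) (τ : P → ℝ) :
    payM (congPayoff I edgeOf C i) p (pertOf ε (unifSimplex P) τ) =
      -pathCost edgeOf (pertCost edgeOf C ε) p τ := by
  have hint : ∀ e, Integrable (fun τ : P → ℝ => C e (edgeLoad edgeOf τ e)) (unifSimplex P) :=
    fun e => (continuousOn_comp_edgeLoad edgeOf hC e).integrable_of_fullSupportOnSimplex
      fullSupportOnSimplex_unifSimplex
  have hpath : Integrable (pathCost edgeOf C p) (unifSimplex P) :=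
    integrable_finsetSum _ fun e _ => hint e
  simp only [payM, congPayoff]
  rw [integral_neg, integral_pertOf h0 h1 hpath]
  simp only [pathCost, pertCost]
  rw [integral_finsetSum _ fun e _ => hint e, Finset.sum_add_distrib, Finset.mul_sum,
    Finset.mul_sum]

/-- At a minimizer of the Beckmann objective subject to lower bounds, a path whose lower bound is
not binding has minimal cost. -/
lemma pathCost_le_of_isMin_beckmann {c : E → ℝ → ℝ}
    (hcont : ∀ e, ContinuousOn (c e) (Set.Icc 0 1)) (hmono : ∀ e, MonotoneOn (c e) (Set.Icc 0 1))
    {τ₀ : P → ℝ} (h0 : 0 ≤ ε) (hmem : τ₀ ∈ stdSimplex ℝ P) (hlb : ∀ p, ε ≤ τ₀ p)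
    (hmin : ∀ τ ∈ stdSimplex ℝ P, (∀ p, ε ≤ τ p) →
      (∑ e : E, ∫ x in (0:ℝ)..(edgeLoad edgeOf τ₀ e), c e x) ≤
        ∑ e : E, ∫ x in (0:ℝ)..(edgeLoad edgeOf τ e), c e x)
    {p : P} (hp : ε < τ₀ p) (q : P) :
    pathCost edgeOf c p τ₀ ≤ pathCost edgeOf c q τ₀ := by
  classical
  set d : P → ℝ := Pi.single q 1 - Pi.single p 1 with hd
  let γ : ℝ → P → ℝ := fun t => τ₀ + t • d
  have hγ : Continuous γ := by fun_prop
  have hγ0 : γ 0 = τ₀ := by simp [γ]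
  have hγlb : ∀ t ∈ Set.Ioo 0 (τ₀ p - ε), ∀ r, ε ≤ γ t r := by
    intro t ht r
    have hr := hlb r
    obtain ⟨ht0, ht1⟩ := ht
    simp only [γ, hd, Pi.add_apply, Pi.smul_apply, Pi.sub_apply, Pi.single_apply, smul_eq_mul]
    split_ifs with h₁ h₂ h₂ <;> subst_vars <;> linarith
  have hγmem : ∀ t ∈ Set.Ioo 0 (τ₀ p - ε), γ t ∈ stdSimplex ℝ P := fun t ht => by
    refine ⟨fun r => h0.trans (hγlb t ht r), ?_⟩
    simp [γ, hd, Finset.sum_add_distrib, ← Finset.mul_sum, hmem.2]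
  have hIoo : Set.Ioo 0 (τ₀ p - ε) ∈ 𝓝[>] (0 : ℝ) := Ioo_mem_nhdsGT (sub_pos.2 hp)
  have hnonneg : ∀ᶠ t in 𝓝[>] (0 : ℝ),
      0 ≤ ∑ e, edgeLoad edgeOf d e * c e (edgeLoad edgeOf (γ t) e) := by
    filter_upwards [hIoo] with t ht
    have hle : ∑ e, ((∫ x in (0:ℝ)..(edgeLoad edgeOf (γ t) e), c e x) -
        ∫ x in (0:ℝ)..(edgeLoad edgeOf τ₀ e), c e x) ≤
        ∑ e, (edgeLoad edgeOf (γ t) e - edgeLoad edgeOf τ₀ e) * c e (edgeLoad edgeOf (γ t) e) :=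
      Finset.sum_le_sum fun e _ => (hmono e).integral_sub_integral_le
        (edgeLoad_mem_Icc edgeOf hmem e) (edgeLoad_mem_Icc edgeOf (hγmem t ht) e)
    rw [Finset.sum_sub_distrib] at hle
    have hload : ∀ e, edgeLoad edgeOf (γ t) e - edgeLoad edgeOf τ₀ e = t * edgeLoad edgeOf d e :=
      fun e => by simp only [γ, edgeLoad_add_smul]; ring
    simp only [hload, mul_assoc, ← Finset.mul_sum] at hle
    exact nonneg_of_mul_nonneg_right
      ((sub_nonneg.2 (hmin _ (hγmem t ht) (hγlb t ht))).trans hle) ht.1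
  have hlim : Tendsto (fun t => ∑ e, edgeLoad edgeOf d e * c e (edgeLoad edgeOf (γ t) e))
      (𝓝[>] 0) (𝓝 (∑ e, edgeLoad edgeOf d e * c e (edgeLoad edgeOf τ₀ e))) := by
    refine tendsto_finsetSum _ fun e _ => Tendsto.const_mul _ ?_
    refine (hcont e _ (edgeLoad_mem_Icc edgeOf hmem e)).tendsto.comp
      (tendsto_nhdsWithin_iff.2 ⟨?_, ?_⟩)
    · have := ((continuous_edgeLoad edgeOf e).comp hγ).tendsto 0
      rw [Function.comp_apply, hγ0] at this
      exact this.mono_left nhdsWithin_le_nhds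
    · filter_upwards [hIoo] with t ht using edgeLoad_mem_Icc edgeOf (hγmem t ht) e
  have hfinal := ge_of_tendsto hlim hnonneg
  simp only [hd, edgeLoad_single_sub_single, sub_mul, ite_mul, one_mul, zero_mul,
    Finset.sum_sub_distrib, Finset.sum_ite_mem, Finset.univ_inter] at hfinal
  exact sub_nonneg.1 hfinal

end CongestionGame

/-- If `τ^ε` minimizes the Beckmann-type objective
`Σ_e ∫_0^{τ(e)} C_e^ε(x) dx` over the flows in the simplex with every coordinate
at least `ε`, then the symmetric profile constantly equal to `τ^ε` is an
`ε`-robust perfect equilibrium, with perturbed player space all of `I` and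
perturbation function `φ(τ) = (1-ε)δ_τ + εη`. -/
theorem statement8 {I : Type*} [MeasurableSpace I]
    {E P : Type*} [Fintype E] [Fintype P] [Nonempty P] [DecidableEq E]
    (lam : Measure I) [IsProbabilityMeasure lam] (hatomless : MeasAtomless lam)
    (edgeOf : P → Finset E) (hedge : ∀ p, (edgeOf p).Nonempty)
    (C : E → ℝ → ℝ) (hC : IsCongestionCost C)
    (ε : ℝ) (hε : ε ∈ Set.Ioo (0:ℝ) (1 / (Fintype.card P : ℝ)))
    (τε : P → ℝ) (hmem : τε ∈ stdSimplex ℝ P) (hlb : ∀ p, ε ≤ τε p)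
    (hmin : ∀ τ ∈ stdSimplex ℝ P, (∀ p, ε ≤ τ p) →
      (∑ e : E, ∫ x in (0:ℝ)..(edgeLoad edgeOf τε e), pertCost edgeOf C ε e x) ≤
        ∑ e : E, ∫ x in (0:ℝ)..(edgeLoad edgeOf τ e), pertCost edgeOf C ε e x) :
    IsEpsRPE lam (congPayoff I edgeOf C) ε (fun _ => τε) Set.univ
      (pertOf ε (unifSimplex P)) := by
  have hcard : (1 : ℝ) ≤ Fintype.card P := by exact_mod_cast Fintype.card_pos (α := P)
  have h0 : 0 < ε := hε.1
  have h1 : ε < 1 := hε.2.trans_le ((div_le_one (by linarith)).2 hcard)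
  refine ⟨⟨measurable_const, fun _ => hmem⟩, ae_of_all _ fun _ p => h0.trans_le (hlb p),
    MeasurableSet.univ, ?_, isPerturbation_pertOf h0 h1.le fullSupportOnSimplex_unifSimplex,
    fun τ _ => ofReal_le_pertOf_singleton τ, fun i _ am al hlt => ?_⟩
  · rw [measure_univ, ← ENNReal.ofReal_one]
    exact (ENNReal.ofReal_lt_ofReal_iff one_pos).2 (by linarith)
  · have hsum : socSum lam (fun _ => τε) = τε := by
      funext p
      simp [socSum]
    rw [hsum, payM_congPayoff_pertOf edgeOf hC h0.le h1.le,
      payM_congPayoff_pertOf edgeOf hC h0.le h1.le, neg_lt_neg_iff] at hlt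
    by_contra! hgt
    exact hlt.not_ge (pathCost_le_of_isMin_beckmann edgeOf
      (continuousOn_pertCost edgeOf hC) (monotoneOn_pertCost edgeOf hC h1.le)
      h0.le hmem hlb hmin hgt al)
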